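/- arXiv:2501.10299 — 2 statements merged into one kernel-verified Lean document; each statement's English description precedes it below -/
import Mathlib

section
/- Let n ≥ 1, let p ≥ 1 be a real number, and let a, b : Fin n → ℝ be real tuples. Then the optimal matching cost min_{σ ∈ S_n} Σ_{i=1}^n |a_i − b_{σ(i)}|^p is achieved by sorting both tuples: min_{σ ∈ S_n} Σ_{i=1}^n |a_i − b_{σ(i)}|^p = Σ_{i=1}^n |a_{(i)} − b_{(i)}|^p, where a_{(1)} ≤ … ≤ a_{(n)} and b_{(1)} ≤ … ≤ b_{(n)} are the sorted rearrangements of a and b. (Closed-form solution of the one-dimensional optimal transport problem between uniform discrete measures with n atoms, Equation (4).) -/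
open Real Finset

noncomputable section

/-- The sorted (monotone nondecreasing) rearrangement of a real tuple. -/
noncomputable def sortedTuple {n : ℕ} (a : Fin n → ℝ) : Fin n → ℝ :=
  a ∘ Tuple.sort a

/-- A convex function of the difference is a Monge cost: uncrossing a pair does not increase it. -/
theorem ConvexOn.sub_add_sub_le_sub_add_sub {φ : ℝ → ℝ} (hφ : ConvexOn ℝ Set.univ φ)
    {x x' y y' : ℝ} (hx : x ≤ x') (hy : y ≤ y') :
    φ (x - y) + φ (x' - y') ≤ φ (x - y') + φ (x' - y) := by
  rcases hx.eq_or_lt with rfl | hx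
  · rw [add_comm]
  have hd : 0 < (x' - x) + (y' - y) := by linarith
  set s := (x' - x) / ((x' - x) + (y' - y))
  set t := (y' - y) / ((x' - x) + (y' - y))
  have hs : 0 ≤ s := div_nonneg (by linarith) hd.le
  have ht : 0 ≤ t := div_nonneg (by linarith) hd.le
  have hst : s + t = 1 := by
    rw [← add_div, div_self hd.ne']
  have hts : t + s = 1 := by rw [add_comm, hst]
  have h₁ := hφ.2 (Set.mem_univ (x - y')) (Set.mem_univ (x' - y)) hs ht hst
  have h₂ := hφ.2 (Set.mem_univ (x - y')) (Set.mem_univ (x' - y)) ht hs hts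
  have e₁ : s • (x - y') + t • (x' - y) = x - y := by
    simp only [s, t, smul_eq_mul]
    field_simp
    ring
  have e₂ : t • (x - y') + s • (x' - y) = x' - y' := by
    simp only [s, t, smul_eq_mul]
    field_simp
    ring
  rw [e₁, smul_eq_mul, smul_eq_mul] at h₁
  rw [e₂, smul_eq_mul, smul_eq_mul] at h₂
  calc φ (x - y) + φ (x' - y')
      ≤ (s * φ (x - y') + t * φ (x' - y)) + (t * φ (x - y') + s * φ (x' - y)) :=
        add_le_add h₁ h₂
    _ = (s + t) * (φ (x - y') + φ (x' - y)) := by ring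
    _ = φ (x - y') + φ (x' - y) := by rw [hst, one_mul]

/-- For a Monge cost, the identity is an optimal assignment among the permutations supported in
a given finite set. -/
theorem Finset.sum_diag_le_sum_perm_of_monge {ι : Type*} [LinearOrder ι] {c : ι → ι → ℝ}
    (hc : ∀ ⦃i i' j j'⦄, i ≤ i' → j ≤ j' → c i j + c i' j' ≤ c i j' + c i' j)
    (s : Finset ι) (σ : Equiv.Perm ι) (hσ : ∀ x, σ x ≠ x → x ∈ s) :
    ∑ i ∈ s, c i i ≤ ∑ i ∈ s, c i (σ i) := by
  induction s using Finset.induction_on_max generalizing σ with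
  | empty => simp
  | insert a s hmax ih =>
    have has : a ∉ s := fun h ↦ (hmax a h).false
    obtain hσa | hσa := eq_or_ne (σ a) a
    · rw [sum_insert has, sum_insert has, hσa]
      refine add_le_add_right (ih σ fun x hx ↦ ?_) _
      exact mem_of_mem_insert_of_ne (hσ x hx) (by rintro rfl; exact hx hσa)
    set τ : Equiv.Perm ι := σ.trans (Equiv.swap a (σ a)) with hτ
    have hτs : ∀ x, τ x ≠ x → x ∈ s := by
      intro x hx
      have hxa : x ≠ a := by
        rintro rfl
        simp [hτ] at hx
      refine mem_of_mem_insert_of_ne (hσ x fun h ↦ hx ?_) hxa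
      rw [hτ, Equiv.trans_apply, h, Equiv.swap_apply_of_ne_of_ne hxa]
      exact fun h' ↦ hxa (σ.injective (h.trans h'))
    have hk : σ.symm a ≠ a := fun h ↦ hσa (by rw [← h, σ.apply_symm_apply, h])
    have hks : σ.symm a ∈ s := by
      refine mem_of_mem_insert_of_ne (hσ _ fun h ↦ hk ?_) hk
      rw [← h, σ.apply_symm_apply]
    have hσas : σ a ∈ s := mem_of_mem_insert_of_ne (hσ _ (σ.injective.ne hσa)) hσa
    have hrest : ∑ i ∈ s.erase (σ.symm a), c i (τ i) = ∑ i ∈ s.erase (σ.symm a), c i (σ i) := by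
      refine sum_congr rfl fun x hx ↦ ?_
      rw [mem_erase, Ne, Equiv.eq_symm_apply] at hx
      rw [hτ, Equiv.trans_apply, Equiv.swap_apply_of_ne_of_ne hx.1 (σ.injective.ne _)]
      rintro rfl
      exact has hx.2
    have hτk : τ (σ.symm a) = σ a := by simp [hτ]
    have hind := ih τ hτs
    rw [← add_sum_erase s (fun i ↦ c i (τ i)) hks, hrest, hτk] at hind
    rw [sum_insert has, sum_insert has, ← add_sum_erase s (fun i ↦ c i (σ i)) hks,
      σ.apply_symm_apply]
    linarith [hc (hmax _ hks).le (hmax _ hσas).le]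

theorem convexOn_abs_rpow {p : ℝ} (hp : 1 ≤ p) : ConvexOn ℝ Set.univ fun x : ℝ ↦ |x| ^ p := by
  refine ⟨convex_univ, fun x _ y _ s t hs ht hst ↦ ?_⟩
  calc |s • x + t • y| ^ p
      ≤ (s • |x| + t • |y|) ^ p := by
        refine Real.rpow_le_rpow (abs_nonneg _) ?_ (by linarith)
        simpa [abs_mul, abs_of_nonneg hs, abs_of_nonneg ht] using abs_add_le (s * x) (t * y)
    _ ≤ s • |x| ^ p + t • |y| ^ p :=
        (convexOn_rpow hp).2 (abs_nonneg x) (abs_nonneg y) hs ht hst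

/-- Closed-form solution of the one-dimensional optimal transport problem between
uniform discrete measures with `n` atoms (Equation (4)): the optimal matching cost is
achieved by sorting both tuples. -/
theorem one_dimensional_optimal_matching
    (n : ℕ) (hn : 1 ≤ n) (p : ℝ) (hp : 1 ≤ p) (a b : Fin n → ℝ) :
    (⨅ σ : Equiv.Perm (Fin n), ∑ i : Fin n, |a i - b (σ i)| ^ p)
      = ∑ i : Fin n, |sortedTuple a i - sortedTuple b i| ^ p := by
  have hreindex (σ : Equiv.Perm (Fin n)) : ∑ i, |a i - b (σ i)| ^ p =
      ∑ i, |sortedTuple a i - b (σ (Tuple.sort a i))| ^ p :=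
    (Equiv.sum_comp (Tuple.sort a) fun i ↦ |a i - b (σ i)| ^ p).symm
  refine le_antisymm ?_ (le_ciInf fun σ ↦ ?_)
  · refine ciInf_le_of_le (Set.finite_range _).bddBelow
      ((Tuple.sort a).symm.trans (Tuple.sort b)) ?_
    rw [hreindex]
    simp [sortedTuple]
  · rw [hreindex]
    have h := Finset.sum_diag_le_sum_perm_of_monge
      (c := fun i j ↦ |sortedTuple a i - sortedTuple b j| ^ p)
      (fun _ _ _ _ hi hj ↦ (convexOn_abs_rpow hp).sub_add_sub_le_sub_add_sub
        (Tuple.monotone_sort a hi) (Tuple.monotone_sort b hj))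
      univ (((Tuple.sort a).trans σ).trans (Tuple.sort b).symm) fun x _ ↦ mem_univ x
    simpa [sortedTuple] using h
end
end

section
/- Let L ≥ 1 and for l = 1, …, L let θ_l = (cos(π(l−1)/(2L)), sin(π(l−1)/(2L))) ∈ ℝ². Then for every v ∈ ℝ², Σ_{l=1}^L ⟪θ_l, v⟫² ≤ (L/2)·(1 + 1/(L·sin(π/(2L))))·‖v‖². (Largest-eigenvalue bound ρ(Θ) = (L/2)(1 + 1/(L sin(π/(2L)))) for Θ = Σ_l θ_l θ_lᵀ, used in the proof of Proposition 2.) -/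
open Real Finset
open scoped RealInnerProductSpace

noncomputable section

/-- Closed form of the Dirichlet-type sum of cosines, multiplied by `2 sin h`. -/
theorem two_mul_sin_mul_sum_cos (h : ℝ) (n : ℕ) :
    2 * sin h * ∑ l ∈ range n, cos (2 * (h * l)) = sin (2 * h * n - h) + sin h := by
  induction n with
  | zero => simp
  | succ n ih =>
    rw [sum_range_succ, mul_add, ih]
    have e₁ : 2 * h * ((n + 1 : ℕ) : ℝ) - h = 2 * (h * n) + h := by push_cast; ring
    have e₂ : 2 * h * (n : ℝ) - h = 2 * (h * n) - h := by ring
    rw [e₁, e₂, sin_add, sin_sub]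
    ring

/-- Closed form of the Dirichlet-type sum of sines, multiplied by `2 sin h`. -/
theorem two_mul_sin_mul_sum_sin (h : ℝ) (n : ℕ) :
    2 * sin h * ∑ l ∈ range n, sin (2 * (h * l)) = cos h - cos (2 * h * n - h) := by
  induction n with
  | zero => simp
  | succ n ih =>
    rw [sum_range_succ, mul_add, ih]
    have e₁ : 2 * h * ((n + 1 : ℕ) : ℝ) - h = 2 * (h * n) + h := by push_cast; ring
    have e₂ : 2 * h * (n : ℝ) - h = 2 * (h * n) - h := by ring
    rw [e₁, e₂, cos_add, cos_sub]
    ring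

theorem cos_mul_add_sin_mul_sq (x a b : ℝ) :
    (cos x * a + sin x * b) ^ 2 =
      (a ^ 2 + b ^ 2) / 2 + cos (2 * x) * ((a ^ 2 - b ^ 2) / 2) + sin (2 * x) * (a * b) := by
  rw [cos_two_mul, sin_two_mul]
  linear_combination b ^ 2 * sin_sq_add_cos_sq x

theorem sin_mul_sq_sub_sq_add_le (h a b : ℝ) :
    sin h * (a ^ 2 - b ^ 2) + 2 * cos h * (a * b) ≤ a ^ 2 + b ^ 2 := by
  refine le_of_sq_le_sq ?_ (by positivity)
  have e : (sin h * (a ^ 2 - b ^ 2) + 2 * cos h * (a * b)) ^ 2 +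
      (cos h * (a ^ 2 - b ^ 2) - 2 * sin h * (a * b)) ^ 2 = (a ^ 2 + b ^ 2) ^ 2 := by
    linear_combination (a ^ 2 + b ^ 2) ^ 2 * sin_sq_add_cos_sq h
  linarith [sq_nonneg (cos h * (a ^ 2 - b ^ 2) - 2 * sin h * (a * b))]

/-- Largest-eigenvalue bound `ρ(Θ) = (L/2)(1 + 1/(L sin(π/(2L))))` for
`Θ = Σ_l θ_l θ_lᵀ` with the quarter-circle grid of directions, used in the proof of
Proposition 2: for every `v ∈ ℝ²`, `Σ_l ⟪θ_l, v⟫² ≤ (L/2)(1 + 1/(L sin(π/(2L))))‖v‖²`. -/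
theorem theta_quadratic_form_upper_bound
    (L : ℕ) (hL : 1 ≤ L)
    (θ : Fin L → EuclideanSpace ℝ (Fin 2))
    (hθ : ∀ l : Fin L, θ l = (EuclideanSpace.equiv (Fin 2) ℝ).symm
      ![Real.cos (π * (l : ℕ) / (2 * (L : ℝ))), Real.sin (π * (l : ℕ) / (2 * (L : ℝ)))]) :
    ∀ v : EuclideanSpace ℝ (Fin 2),
      (∑ l : Fin L, ⟪θ l, v⟫ ^ 2)
        ≤ ((L : ℝ) / 2) * (1 + 1 / ((L : ℝ) * Real.sin (π / (2 * (L : ℝ))))) * ‖v‖ ^ 2 := by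
  intro v
  have hL0 : (0 : ℝ) < L := by exact_mod_cast hL
  have hL1 : (1 : ℝ) ≤ L := by exact_mod_cast hL
  set h : ℝ := π / (2 * (L : ℝ)) with hh
  have hs : 0 < sin h := by
    apply sin_pos_of_pos_of_lt_pi (by positivity)
    rw [hh, div_lt_iff₀ (by positivity)]
    nlinarith [pi_pos]
  have hend : 2 * h * (L : ℝ) - h = π - h := by
    rw [hh]; field_simp
  have hC := two_mul_sin_mul_sum_cos h L
  have hS := two_mul_sin_mul_sum_sin h L
  rw [hend, sin_pi_sub] at hC
  rw [hend, cos_pi_sub] at hS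
  have hterm : ∀ l : Fin L, ⟪θ l, v⟫ ^ 2 = (v 0 ^ 2 + v 1 ^ 2) / 2
      + cos (2 * (h * (l : ℕ))) * ((v 0 ^ 2 - v 1 ^ 2) / 2)
      + sin (2 * (h * (l : ℕ))) * (v 0 * v 1) := by
    intro l
    have hangle : π * (l : ℕ) / (2 * (L : ℝ)) = h * (l : ℕ) := by rw [hh]; ring
    rw [hθ l, hangle]
    simp only [← cos_mul_add_sin_mul_sq]
    simp [PiLp.inner_apply, Fin.sum_univ_two, mul_comm]
  rw [sum_congr rfl fun l _ => hterm l,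
    Fin.sum_univ_eq_sum_range (fun k : ℕ => (v 0 ^ 2 + v 1 ^ 2) / 2
      + cos (2 * (h * k)) * ((v 0 ^ 2 - v 1 ^ 2) / 2) + sin (2 * (h * k)) * (v 0 * v 1)) L,
    sum_add_distrib, sum_add_distrib, ← sum_mul, ← sum_mul, sum_const, card_range, nsmul_eq_mul,
    EuclideanSpace.real_norm_sq_eq, Fin.sum_univ_two]
  have hbound : (∑ l ∈ range L, cos (2 * (h * l))) * ((v 0 ^ 2 - v 1 ^ 2) / 2) +
      (∑ l ∈ range L, sin (2 * (h * l))) * (v 0 * v 1) ≤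
        (v 0 ^ 2 + v 1 ^ 2) / (2 * sin h) := by
    rw [le_div_iff₀ (by positivity)]
    calc _ = sin h * (v 0 ^ 2 - v 1 ^ 2) + 2 * cos h * (v 0 * v 1) := by
          linear_combination ((v 0 ^ 2 - v 1 ^ 2) / 2) * hC + (v 0 * v 1) * hS
      _ ≤ _ := sin_mul_sq_sub_sq_add_le h (v 0) (v 1)
  calc _ ≤ (L : ℝ) * ((v 0 ^ 2 + v 1 ^ 2) / 2) + (v 0 ^ 2 + v 1 ^ 2) / (2 * sin h) := by linarith
    _ = _ := by field_simp
end
end
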